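/- Cauchy-matrix solutions of the potential self-dual Yang–Mills equation. Work on ℝ⁴ with coordinates (x¹, x², x̄¹, x̄²) and corresponding partial derivatives ∂₁, ∂₂, ∂₁̄, ∂₂̄. Let a, b be nonzero real constants, and let P = diag(p₁,…,p_r), Q = diag(q₁,…,q_r) be constant diagonal complex matrices with p_i ≠ q_j for all i, j. Let θ : ℝ⁴ → M_{m×r}(ℂ) and η : ℝ⁴ → M_{r×m}(ℂ) be smooth solutions of the zero-seed linear systems a·∂₁̄θ = (∂₂θ)·Q, b·∂₂̄θ = (∂₁θ)·Q, a·∂₁̄η = P·(∂₂η), b·∂₂̄η = P·(∂₁η). Define Ω : ℝ⁴ → M_r(ℂ) entrywise by Ω_{ij} := (ηθ)_{ij} / (p_i − q_j). Then on any open subset of ℝ⁴ where Ω is invertible, the function φ := −θΩ^{-1}η satisfies the potential self-dual Yang–Mills equation b·∂₂∂₂̄φ − a·∂₁∂₁̄φ = [∂₁φ, ∂₂φ]. -/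

import Mathlib

open scoped BigOperators

/-- Partial derivative of a real-valued function on `ℝⁿ` in the `μ`-th coordinate direction. -/
noncomputable def pd {n : ℕ} (μ : Fin n) (f : (Fin n → ℝ) → ℝ) (x : Fin n → ℝ) : ℝ :=
  fderiv ℝ f x (Pi.single μ 1)

/-- Entrywise partial derivative of a matrix-valued function on `ℝⁿ`.
On `ℝ⁴` with coordinates `(x¹, x², x̄¹, x̄²)`, `∂₁ = pdM 0`, `∂₂ = pdM 1`,
`∂₁̄ = pdM 2`, `∂₂̄ = pdM 3`. -/
noncomputable def pdM {n m r : ℕ} (μ : Fin n) (f : (Fin n → ℝ) → Matrix (Fin m) (Fin r) ℂ)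
    (x : Fin n → ℝ) : Matrix (Fin m) (Fin r) ℂ :=
  Matrix.of fun i j => fderiv ℝ (fun y => f y i j) x (Pi.single μ 1)

/-- A matrix-valued function all of whose entries are smooth at a point. -/
def EntrySmoothAt {n m r : ℕ} (f : (Fin n → ℝ) → Matrix (Fin m) (Fin r) ℂ)
    (x : Fin n → ℝ) : Prop :=
  ∀ i j, ContDiffAt ℝ (⊤ : ℕ∞) (fun y => f y i j) x

namespace EntrySmoothAt

variable {n m r k : ℕ} {x : Fin n → ℝ}

theorem differentiableAt {f : (Fin n → ℝ) → Matrix (Fin m) (Fin r) ℂ} (hf : EntrySmoothAt f x)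
    (i : Fin m) (j : Fin r) : DifferentiableAt ℝ (fun y => f y i j) x :=
  (hf i j).differentiableAt (by simp)

theorem const (A : Matrix (Fin m) (Fin r) ℂ) : EntrySmoothAt (fun _ => A) x :=
  fun _ _ => contDiffAt_const

theorem neg {f : (Fin n → ℝ) → Matrix (Fin m) (Fin r) ℂ} (hf : EntrySmoothAt f x) :
    EntrySmoothAt (fun y => -f y) x :=
  fun i j => (hf i j).neg

theorem mul {f : (Fin n → ℝ) → Matrix (Fin m) (Fin k) ℂ}
    {g : (Fin n → ℝ) → Matrix (Fin k) (Fin r) ℂ}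
    (hf : EntrySmoothAt f x) (hg : EntrySmoothAt g x) :
    EntrySmoothAt (fun y => f y * g y) x := by
  intro i j
  simp only [Matrix.mul_apply]
  exact ContDiffAt.sum fun l _ => (hf i l).mul (hg l j)

theorem pdM {f : (Fin n → ℝ) → Matrix (Fin m) (Fin r) ℂ} (hf : EntrySmoothAt f x) (μ : Fin n) :
    EntrySmoothAt (pdM μ f) x := fun i j =>
  ((hf i j).fderiv_right (m := (⊤ : ℕ∞)) (by simp)).clm_apply contDiffAt_const

theorem det {f : (Fin n → ℝ) → Matrix (Fin r) (Fin r) ℂ} (hf : EntrySmoothAt f x) :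
    ContDiffAt ℝ (⊤ : ℕ∞) (fun y => (f y).det) x := by
  simp only [Matrix.det_apply']
  exact ContDiffAt.sum fun σ _ => contDiffAt_const.mul (contDiffAt_prod fun i _ => hf _ _)

theorem adjugate {f : (Fin n → ℝ) → Matrix (Fin r) (Fin r) ℂ} (hf : EntrySmoothAt f x) :
    EntrySmoothAt (fun y => (f y).adjugate) x := by
  intro i j
  simp only [Matrix.adjugate_apply]
  refine det fun k l => ?_
  by_cases h : k = j
  · subst h
    simpa using contDiffAt_const
  · simpa [Matrix.updateRow_ne h] using hf k l

theorem inv {f : (Fin n → ℝ) → Matrix (Fin r) (Fin r) ℂ} (hf : EntrySmoothAt f x)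
    (hx : IsUnit (f x)) : EntrySmoothAt (fun y => (f y)⁻¹) x := by
  intro i j
  simp only [Matrix.inv_def, Ring.inverse_eq_inv', Matrix.smul_apply, smul_eq_mul]
  exact (hf.det.inv ((Matrix.isUnit_iff_isUnit_det _).1 hx).ne_zero).mul (hf.adjugate i j)

end EntrySmoothAt

section pdM

variable {n m r k : ℕ} {x : Fin n → ℝ}

theorem pdM_congr (μ : Fin n) {f g : (Fin n → ℝ) → Matrix (Fin m) (Fin r) ℂ}
    (h : f =ᶠ[nhds x] g) : pdM μ f x = pdM μ g x := by
  ext i j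
  have h' : (fun y => f y i j) =ᶠ[nhds x] fun y => g y i j := h.mono fun y hy => by simp only [hy]
  simp only [pdM, Matrix.of_apply, h'.fderiv_eq]

theorem pdM_const (μ : Fin n) (A : Matrix (Fin m) (Fin r) ℂ) : pdM μ (fun _ => A) x = 0 := by
  ext i j
  simp [pdM]

theorem pdM_neg (μ : Fin n) (f : (Fin n → ℝ) → Matrix (Fin m) (Fin r) ℂ) :
    pdM μ (fun y => -f y) x = -pdM μ f x := by
  ext i j
  simp [pdM, fderiv_fun_neg]

theorem pdM_smul (μ : Fin n) (a : ℝ) {f : (Fin n → ℝ) → Matrix (Fin m) (Fin r) ℂ}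
    (hf : EntrySmoothAt f x) : pdM μ (fun y => a • f y) x = a • pdM μ f x := by
  ext i j
  simp only [pdM, Matrix.of_apply, Matrix.smul_apply]
  rw [fderiv_fun_const_smul (hf.differentiableAt i j)]
  rfl

theorem pdM_add (μ : Fin n) {f g : (Fin n → ℝ) → Matrix (Fin m) (Fin r) ℂ}
    (hf : EntrySmoothAt f x) (hg : EntrySmoothAt g x) :
    pdM μ (fun y => f y + g y) x = pdM μ f x + pdM μ g x := by
  ext i j
  simp only [pdM, Matrix.of_apply, Matrix.add_apply]
  rw [fderiv_fun_add (hf.differentiableAt i j) (hg.differentiableAt i j)]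
  rfl

theorem pdM_mul (μ : Fin n) {f : (Fin n → ℝ) → Matrix (Fin m) (Fin k) ℂ}
    {g : (Fin n → ℝ) → Matrix (Fin k) (Fin r) ℂ}
    (hf : EntrySmoothAt f x) (hg : EntrySmoothAt g x) :
    pdM μ (fun y => f y * g y) x = pdM μ f x * g x + f x * pdM μ g x := by
  ext i j
  simp only [pdM, Matrix.of_apply, Matrix.add_apply, Matrix.mul_apply]
  rw [fderiv_fun_sum fun l _ => (hf.differentiableAt i l).fun_mul (hg.differentiableAt l j),
    sum_apply, ← Finset.sum_add_distrib]
  refine Finset.sum_congr rfl fun l _ => ?_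
  rw [fderiv_fun_mul (hf.differentiableAt i l) (hg.differentiableAt l j)]
  simp only [add_apply, smul_apply, smul_eq_mul]
  ring

theorem pdM_inv (μ : Fin n) {f : (Fin n → ℝ) → Matrix (Fin r) (Fin r) ℂ}
    (hf : EntrySmoothAt f x) (hu : ∀ᶠ y in nhds x, IsUnit (f y)) :
    pdM μ (fun y => (f y)⁻¹) x = -((f x)⁻¹ * pdM μ f x * (f x)⁻¹) := by
  have hx := (Matrix.isUnit_iff_isUnit_det _).1 hu.self_of_nhds
  have h : pdM μ (fun y => (f y)⁻¹ * f y) x = 0 := by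
    rw [pdM_congr μ (hu.mono fun y hy =>
      Matrix.nonsing_inv_mul _ ((Matrix.isUnit_iff_isUnit_det _).1 hy)), pdM_const]
  rw [pdM_mul μ (hf.inv hu.self_of_nhds) hf] at h
  have h2 := congrArg (· * (f x)⁻¹) h
  simp only [add_mul, zero_mul, mul_assoc, Matrix.mul_nonsing_inv _ hx, mul_one] at h2
  rw [mul_assoc]
  exact eq_neg_of_add_eq_zero_left h2

theorem pdM_comm (μ ν : Fin n) {f : (Fin n → ℝ) → Matrix (Fin m) (Fin r) ℂ}
    (hf : EntrySmoothAt f x) : pdM μ (pdM ν f) x = pdM ν (pdM μ f) x := by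
  ext i j
  have hd : DifferentiableAt ℝ (fderiv ℝ fun y => f y i j) x :=
    ((hf i j).fderiv_right (m := (⊤ : ℕ∞)) (by simp)).differentiableAt (by simp)
  have hs : IsSymmSndFDerivAt ℝ (fun y => f y i j) x :=
    (hf i j).isSymmSndFDerivAt (by simpa using WithTop.coe_le_coe.2 (le_top (a := (2 : ℕ∞))))
  simp only [pdM, Matrix.of_apply]
  rw [fderiv_clm_apply hd (differentiableAt_const _), fderiv_clm_apply hd (differentiableAt_const _)]
  simpa using hs.eq _ _

end pdM

theorem Matrix.eq_of_diagonal_mul_sub_mul_diagonal_eq {r : ℕ} {p q : Fin r → ℂ}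
    (hpq : ∀ i j, p i ≠ q j) {X Y : Matrix (Fin r) (Fin r) ℂ}
    (h : diagonal p * X - X * diagonal q = diagonal p * Y - Y * diagonal q) : X = Y := by
  ext i j
  have hij := congrFun (congrFun h i) j
  simp only [sub_apply, diagonal_mul, mul_diagonal] at hij
  refine mul_left_cancel₀ (sub_ne_zero.2 (hpq i j)) ?_
  linear_combination hij

/-- Each barred first derivative of `φ = -θ Ω⁻¹ η` is an unbarred derivative of the potential
`S = -θ Ω⁻¹ P η` up to a quadratic term in `φ`. -/
theorem smul_pdM_cauchy {n m r : ℕ} (d e : Fin n) (a : ℝ) {p q : Fin r → ℂ}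
    (hpq : ∀ i j, p i ≠ q j)
    {θ : (Fin n → ℝ) → Matrix (Fin m) (Fin r) ℂ} {η : (Fin n → ℝ) → Matrix (Fin r) (Fin m) ℂ}
    {Ω : (Fin n → ℝ) → Matrix (Fin r) (Fin r) ℂ} {x : Fin n → ℝ}
    (hθs : EntrySmoothAt θ x) (hηs : EntrySmoothAt η x) (hΩs : EntrySmoothAt Ω x)
    (hθ : a • pdM e θ x = pdM d θ x * Matrix.diagonal q)
    (hη : a • pdM e η x = Matrix.diagonal p * pdM d η x)
    (hΩ : ∀ y, Matrix.diagonal p * Ω y = η y * θ y + Ω y * Matrix.diagonal q)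
    (hu : ∀ᶠ y in nhds x, IsUnit (Ω y)) :
    a • pdM e (fun y => -(θ y * (Ω y)⁻¹ * η y)) x =
      pdM d (fun y => -(θ y * (Ω y)⁻¹ * (Matrix.diagonal p * η y))) x +
        pdM d (fun y => -(θ y * (Ω y)⁻¹ * η y)) x * -(θ x * (Ω x)⁻¹ * η x) := by
  have hx := (Matrix.isUnit_iff_isUnit_det _).1 hu.self_of_nhds
  have hW := hΩs.inv hu.self_of_nhds
  have hP := EntrySmoothAt.const (x := x) (Matrix.diagonal p)
  have hQ := EntrySmoothAt.const (x := x) (Matrix.diagonal q)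
  have hL : ∀ μ, Matrix.diagonal p * pdM μ Ω x =
      pdM μ η x * θ x + η x * pdM μ θ x + pdM μ Ω x * Matrix.diagonal q := by
    intro μ
    have h := pdM_congr (x := x) μ (Filter.Eventually.of_forall hΩ)
    rw [pdM_mul μ hP hΩs, pdM_add μ (hηs.mul hθs) (hΩs.mul hQ), pdM_mul μ hηs hθs,
      pdM_mul μ hΩs hQ, pdM_const, pdM_const] at h
    simpa using h
  have hΩe : a • pdM e Ω x = pdM d Ω x * Matrix.diagonal q + pdM d η x * θ x := by
    refine Matrix.eq_of_diagonal_mul_sub_mul_diagonal_eq hpq ?_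
    rw [Matrix.mul_smul, hL e, mul_add, ← mul_assoc, hL d]
    rw [smul_add, smul_add, ← Matrix.smul_mul, ← Matrix.mul_smul (η x), hθ, hη]
    simp only [Matrix.add_mul, Matrix.mul_assoc, Matrix.smul_mul]
    abel
  have hQW : Matrix.diagonal q * (Ω x)⁻¹ =
      (Ω x)⁻¹ * Matrix.diagonal p - (Ω x)⁻¹ * (η x * θ x) * (Ω x)⁻¹ := by
    rw [eq_sub_of_add_eq (hΩ x).symm, mul_sub, sub_mul, ← mul_assoc _ (Ω x) (Matrix.diagonal q),
      Matrix.nonsing_inv_mul _ hx, one_mul, mul_assoc _ (Matrix.diagonal p * Ω x),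
      mul_assoc (Matrix.diagonal p), Matrix.mul_nonsing_inv _ hx, mul_one, sub_sub_cancel]
  have hφ : ∀ μ, pdM μ (fun y => -(θ y * (Ω y)⁻¹ * η y)) x =
      -(pdM μ θ x * (Ω x)⁻¹ * η x - θ x * ((Ω x)⁻¹ * pdM μ Ω x * (Ω x)⁻¹) * η x
        + θ x * (Ω x)⁻¹ * pdM μ η x) := by
    intro μ
    rw [pdM_neg, pdM_mul μ (hθs.mul hW) hηs, pdM_mul μ hθs hW, pdM_inv μ hΩs hu]
    simp only [Matrix.add_mul, Matrix.mul_neg, Matrix.neg_mul, sub_eq_add_neg]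
  have hS : pdM d (fun y => -(θ y * (Ω y)⁻¹ * (Matrix.diagonal p * η y))) x =
      -(pdM d θ x * (Ω x)⁻¹ * (Matrix.diagonal p * η x)
        - θ x * ((Ω x)⁻¹ * pdM d Ω x * (Ω x)⁻¹) * (Matrix.diagonal p * η x)
        + θ x * (Ω x)⁻¹ * (Matrix.diagonal p * pdM d η x)) := by
    rw [pdM_neg, pdM_mul d (hθs.mul hW) (hP.mul hηs), pdM_mul d hθs hW, pdM_inv d hΩs hu,
      pdM_mul d hP hηs, pdM_const]
    simp only [Matrix.add_mul, Matrix.mul_neg, Matrix.neg_mul, sub_eq_add_neg, Matrix.zero_mul,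
      zero_add]
  have hQW' (Z : Matrix (Fin r) (Fin m) ℂ) : Matrix.diagonal q * ((Ω x)⁻¹ * Z) =
      (Ω x)⁻¹ * (Matrix.diagonal p * Z) - (Ω x)⁻¹ * (η x * (θ x * ((Ω x)⁻¹ * Z))) := by
    rw [← Matrix.mul_assoc, hQW]
    simp only [Matrix.sub_mul, Matrix.mul_assoc]
  have hφe : a • pdM e (fun y => -(θ y * (Ω y)⁻¹ * η y)) x =
      -((a • pdM e θ x) * (Ω x)⁻¹ * η x - θ x * ((Ω x)⁻¹ * (a • pdM e Ω x) * (Ω x)⁻¹) * η x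
        + θ x * (Ω x)⁻¹ * (a • pdM e η x)) := by
    rw [hφ]
    simp only [smul_neg, smul_add, smul_sub, Matrix.smul_mul, Matrix.mul_smul]
  rw [hφe, hφ, hS, hθ, hη, hΩe]
  simp only [Matrix.add_mul, Matrix.mul_add, Matrix.sub_mul, Matrix.mul_sub, Matrix.mul_assoc,
    Matrix.neg_mul, Matrix.mul_neg, hQW']
  abel

/-- Cauchy-matrix solutions of the potential self-dual Yang–Mills equation
`b·∂₂∂₂̄φ − a·∂₁∂₁̄φ = [∂₁φ, ∂₂φ]`. -/
theorem statement14 {m r : ℕ} (a b : ℝ) (ha : a ≠ 0) (hb : b ≠ 0)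
    (p q : Fin r → ℂ) (hpq : ∀ i j, p i ≠ q j)
    (θ : (Fin 4 → ℝ) → Matrix (Fin m) (Fin r) ℂ)
    (η : (Fin 4 → ℝ) → Matrix (Fin r) (Fin m) ℂ)
    (hθs : ∀ i j, ContDiff ℝ (⊤ : ℕ∞) (fun y => θ y i j))
    (hηs : ∀ i j, ContDiff ℝ (⊤ : ℕ∞) (fun y => η y i j))
    (hθ1 : ∀ x, a • pdM 2 θ x = pdM 1 θ x * Matrix.diagonal q)
    (hθ2 : ∀ x, b • pdM 3 θ x = pdM 0 θ x * Matrix.diagonal q)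
    (hη1 : ∀ x, a • pdM 2 η x = Matrix.diagonal p * pdM 1 η x)
    (hη2 : ∀ x, b • pdM 3 η x = Matrix.diagonal p * pdM 0 η x)
    (Ω : (Fin 4 → ℝ) → Matrix (Fin r) (Fin r) ℂ)
    (hΩ : Ω = fun x => Matrix.of fun i j => (η x * θ x) i j / (p i - q j))
    (φ : (Fin 4 → ℝ) → Matrix (Fin m) (Fin m) ℂ)
    (hφ : φ = fun x => -(θ x * (Ω x)⁻¹ * η x)) :
    ∀ V : Set (Fin 4 → ℝ), IsOpen V → (∀ x ∈ V, IsUnit (Ω x)) →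
      ∀ x ∈ V,
        b • pdM 1 (pdM 3 φ) x - a • pdM 0 (pdM 2 φ) x
          = pdM 0 φ x * pdM 1 φ x - pdM 1 φ x * pdM 0 φ x := by
  intro V hV hVu x hx
  have hθ (y) : EntrySmoothAt θ y := fun i j => (hθs i j).contDiffAt
  have hη (y) : EntrySmoothAt η y := fun i j => (hηs i j).contDiffAt
  have hΩs (y) : EntrySmoothAt Ω y := fun i j => by
    simp only [hΩ, Matrix.of_apply]
    exact ((hη y).mul (hθ y) i j).div_const _
  have hSyl (y) : Matrix.diagonal p * Ω y = η y * θ y + Ω y * Matrix.diagonal q := by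
    ext i j
    simp only [hΩ, Matrix.add_apply, Matrix.diagonal_mul, Matrix.mul_diagonal, Matrix.of_apply]
    have := sub_ne_zero.2 (hpq i j)
    field_simp
    ring
  have hu : ∀ y ∈ V, ∀ᶠ z in nhds y, IsUnit (Ω z) := fun y hy =>
    Filter.mem_of_superset (hV.mem_nhds hy) hVu
  have hW := (hΩs x).inv (hVu x hx)
  have hφs : EntrySmoothAt φ x := hφ ▸ (((hθ x).mul hW).mul (hη x)).neg
  set S : (Fin 4 → ℝ) → Matrix (Fin m) (Fin m) ℂ :=
    fun y => -(θ y * (Ω y)⁻¹ * (Matrix.diagonal p * η y))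
  have hSs : EntrySmoothAt S x := (((hθ x).mul hW).mul ((EntrySmoothAt.const _).mul (hη x))).neg
  have h1 : (fun y => a • pdM 2 φ y) =ᶠ[nhds x] fun y => pdM 1 S y + pdM 1 φ y * φ y := by
    filter_upwards [hV.mem_nhds hx] with y hy
    rw [hφ]
    exact smul_pdM_cauchy 1 2 a hpq (hθ y) (hη y) (hΩs y) (hθ1 y) (hη1 y) hSyl (hu y hy)
  have h2 : (fun y => b • pdM 3 φ y) =ᶠ[nhds x] fun y => pdM 0 S y + pdM 0 φ y * φ y := by
    filter_upwards [hV.mem_nhds hx] with y hy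
    rw [hφ]
    exact smul_pdM_cauchy 0 3 b hpq (hθ y) (hη y) (hΩs y) (hθ2 y) (hη2 y) hSyl (hu y hy)
  rw [← pdM_smul 1 b (hφs.pdM 3), ← pdM_smul 0 a (hφs.pdM 2), pdM_congr 1 h2, pdM_congr 0 h1,
    pdM_add 1 (hSs.pdM 0) ((hφs.pdM 0).mul hφs), pdM_add 0 (hSs.pdM 1) ((hφs.pdM 1).mul hφs),
    pdM_mul 1 (hφs.pdM 0) hφs, pdM_mul 0 (hφs.pdM 1) hφs, pdM_comm 1 0 hSs, pdM_comm 1 0 hφs]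
  abel
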